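/- For all integers k ≥ 0 and all n with 0 ≤ n ≤ N, the k-th power of the first Kravchuk derivation satisfies D_{K1}^k(x_n) = 2^{−k} · ∑_{i=0}^{n−k} S^{(k)}(n−i) · x_i, the sum being empty when k > n. -/

import Mathlib

/-- The variable `x_i` of `ℚ[x_0,…,x_N]` (for `i ≤ N`). -/
noncomputable def Xv (N : ℕ) (i : ℕ) : MvPolynomial (Fin (N + 1)) ℚ :=
  if h : i ≤ N then MvPolynomial.X ⟨i, Nat.lt_succ_of_le h⟩ else 0

/-- The first Kravchuk derivation: `D_{K1}(x_0)=0`,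
`D_{K1}(x_m)=∑_{i=1}^m ((1-(-1)^i)/(2i)) x_{m-i}`. -/
noncomputable def DK1 (N : ℕ) :
    Derivation ℚ (MvPolynomial (Fin (N + 1)) ℚ) (MvPolynomial (Fin (N + 1)) ℚ) :=
  MvPolynomial.mkDerivation ℚ fun m : Fin (N + 1) =>
    ∑ i ∈ Finset.Icc 1 (m : ℕ),
      MvPolynomial.C ((1 - (-1 : ℚ) ^ i) / (2 * i)) * Xv N ((m : ℕ) - i)

/-- Signed Stirling numbers of the first kind: `t(t-1)⋯(t-m+1) = ∑_k s(m,k) t^k`. -/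
noncomputable def stirling1 (m k : ℕ) : ℚ := (descPochhammer ℚ m).coeff k

/-- `S^{(k)}(n) = ∑_{m=k}^n binom(n-1,m-1) (2^m k!/m!) s(m,k)` for `k ≥ 1` (zero for
`n < k`), with `S^{(0)}(n) = 1` if `n = 0` and `0` otherwise. -/
noncomputable def Sfun (k n : ℕ) : ℚ :=
  if k = 0 then (if n = 0 then 1 else 0)
  else ∑ m ∈ Finset.Icc k n,
    ((n - 1).choose (m - 1) : ℚ) * (2 ^ m * (Nat.factorial k) / (Nat.factorial m))
      * stirling1 m k

/-- The generating series of the coefficients of the derivation (`artanh`). -/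
noncomputable def KA : PowerSeries ℚ := PowerSeries.mk fun i => (1 - (-1 : ℚ) ^ i) / (2 * i)

def Kc : ℕ → ℕ → ℚ
  | 0, 0 => 1
  | _ + 1, 0 => 0
  | 0, _ + 1 => 0
  | n + 1, m + 1 => (n.choose m : ℚ)

noncomputable def Ke (m : ℕ) : Polynomial ℚ :=
  Polynomial.C ((2 : ℚ) ^ m / (Nat.factorial m)) * descPochhammer ℚ m

noncomputable def KP (n : ℕ) : Polynomial ℚ :=
  ∑ m ∈ Finset.range (n + 1), Polynomial.C (Kc n m) * Ke m

lemma Kc_zero_of_lt (n m : ℕ) (h : n < m) : Kc n m = 0 := by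
  cases n <;> cases m <;> simp_all [Kc]
  exact Nat.choose_eq_zero_of_lt h

lemma KP_eq (n M : ℕ) (h : n < M) :
    KP n = ∑ m ∈ Finset.range M, Polynomial.C (Kc n m) * Ke m := by
  unfold KP
  apply Finset.sum_subset
  · intro x hx; simp at hx ⊢; omega
  · intro x _ hx
    simp at hx
    rw [Kc_zero_of_lt n x (by omega)]; simp

lemma Ke_rec (m : ℕ) : 2 * Polynomial.X * Ke m
    = Polynomial.C ((m : ℚ) + 1) * Ke (m + 1) + Polynomial.C (2 * (m : ℚ)) * Ke m := by
  unfold Ke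
  rw [descPochhammer_succ_right]
  have h : Polynomial.C ((m : ℚ) + 1) * Polynomial.C ((2 : ℚ) ^ (m + 1) / (Nat.factorial (m + 1)))
      = 2 * Polynomial.C ((2 : ℚ) ^ m / (Nat.factorial m)) := by
    rw [← Polynomial.C_mul]
    have : (2 : Polynomial ℚ) = Polynomial.C 2 := rfl
    rw [this, ← Polynomial.C_mul]
    congr 1
    rw [Nat.factorial_succ]
    push_cast
    have := Nat.factorial_ne_zero m
    field_simp
    ring
  rw [← mul_assoc (Polynomial.C ((m : ℚ) + 1)), h]
  simp only [Polynomial.C_mul, map_natCast]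
  have : (2 : Polynomial ℚ) = Polynomial.C 2 := rfl
  rw [← this]
  ring

/-- Coefficient identity. -/
lemma Kc_rec (p m : ℕ) : ((p : ℚ) + 3) * Kc (p + 3) (m + 1)
    = ((p : ℚ) + 1) * Kc (p + 1) (m + 1)
      + ((m : ℚ) + 1) * (Kc (p + 2) m + 2 * Kc (p + 2) (m + 1)) := by
  have h1 : ((p : ℚ) + 2 - m) * ((p + 2).choose m : ℚ) = (p + 2) * ((p + 1).choose m : ℚ) := by
    rcases le_or_gt m (p + 2) with h | h
    · have := Nat.choose_mul_succ_eq (p + 1) m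
      have h2 : ((p + 1 + 1 - m : ℕ) : ℚ) = p + 2 - m := by
        rw [Nat.cast_sub (by omega)]; push_cast; ring
      rw [← h2]
      have h3 : (((p + 1).choose m * (p + 1 + 1) : ℕ) : ℚ)
        = (((p + 1 + 1).choose m * (p + 1 + 1 - m) : ℕ) : ℚ) := by rw [this]
      rw [Nat.cast_mul, Nat.cast_mul] at h3
      rw [mul_comm, ← h3]; push_cast; ring
    · rw [Nat.choose_eq_zero_of_lt h, Nat.choose_eq_zero_of_lt (by omega)]; simp
  have h1' : ((p : ℚ) + 1 - m) * ((p + 1).choose m : ℚ) = (p + 1) * (p.choose m : ℚ) := by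
    rcases le_or_gt m (p + 1) with h | h
    · have := Nat.choose_mul_succ_eq p m
      have h2 : ((p + 1 - m : ℕ) : ℚ) = p + 1 - m := by
        rw [Nat.cast_sub (by omega)]; push_cast; ring
      rw [← h2]
      have h3 : ((p.choose m * (p + 1) : ℕ) : ℚ)
        = (((p + 1).choose m * (p + 1 - m) : ℕ) : ℚ) := by rw [this]
      rw [Nat.cast_mul, Nat.cast_mul] at h3
      rw [mul_comm, ← h3]; push_cast; ring
    · rw [Nat.choose_eq_zero_of_lt h, Nat.choose_eq_zero_of_lt (by omega)]; simp
  cases m with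
  | zero => simp [Kc]; ring
  | succ j =>
    have h4 : ((p + 2).choose (j + 1) : ℚ) = (p + 1).choose j + (p + 1).choose (j + 1) := by
      rw [Nat.choose_succ_succ]; push_cast; ring
    simp only [Kc]
    push_cast at *
    linear_combination h1 + h1' + ((j : ℚ) + 2) * h4

lemma KP_mul (n M : ℕ) (h : n < M) : 2 * Polynomial.X * KP n
    = ∑ m ∈ Finset.range M,
        Polynomial.C (((m : ℚ) + 1) * (Kc n m + 2 * Kc n (m + 1))) * Ke (m + 1) := by
  rw [KP_eq n (M + 1) (by omega), Finset.mul_sum]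
  have h1 : ∀ m ∈ Finset.range (M + 1), 2 * Polynomial.X * (Polynomial.C (Kc n m) * Ke m)
      = Polynomial.C (((m : ℚ) + 1) * Kc n m) * Ke (m + 1)
        + Polynomial.C (2 * (m : ℚ) * Kc n m) * Ke m := by
    intro m _
    rw [Polynomial.C_mul, Polynomial.C_mul (b := Kc n m)]
    linear_combination Polynomial.C (Kc n m) * Ke_rec m
  rw [Finset.sum_congr rfl h1, Finset.sum_add_distrib, Finset.sum_range_succ,
    Finset.sum_range_succ' (fun m : ℕ => Polynomial.C (2 * (m : ℚ) * Kc n m) * Ke m),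
    Kc_zero_of_lt n M h]
  simp only [mul_zero, map_zero, zero_mul, add_zero, Nat.cast_zero]
  rw [← Finset.sum_add_distrib]
  apply Finset.sum_congr rfl
  intro m _
  rw [← add_mul, ← Polynomial.C_add]
  congr 2
  push_cast; ring

lemma KP_rec (p : ℕ) : Polynomial.C ((p : ℚ) + 3) * KP (p + 3)
    = Polynomial.C ((p : ℚ) + 1) * KP (p + 1) + 2 * Polynomial.X * KP (p + 2) := by
  rw [KP_mul (p + 2) (p + 4) (by omega), KP_eq (p + 3) (p + 5) (by omega),
    KP_eq (p + 1) (p + 5) (by omega), Finset.sum_range_succ' _ (p + 4),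
    Finset.sum_range_succ' _ (p + 4)]
  have z1 : Kc (p + 3) 0 = 0 := rfl
  have z2 : Kc (p + 1) 0 = 0 := rfl
  simp only [z1, z2, map_zero, zero_mul, add_zero]
  rw [Finset.mul_sum, Finset.mul_sum, ← Finset.sum_add_distrib]
  apply Finset.sum_congr rfl
  intro m _
  rw [← mul_assoc, ← mul_assoc, ← add_mul, ← Polynomial.C_mul, ← Polynomial.C_mul,
    ← Polynomial.C_add]
  congr 2
  exact Kc_rec p m

lemma KP_zero : KP 0 = 1 := by simp [KP, Kc, Ke]

lemma KP_one : KP 1 = 2 * Polynomial.X := by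
  have : (2 : Polynomial ℚ) = Polynomial.C 2 := rfl
  simp [KP, Kc, Ke, Finset.sum_range_succ, this]

lemma KP_two : Polynomial.C 2 * KP 2 = 2 * Polynomial.X * KP 1 := by
  rw [KP_mul 1 2 (by omega)]
  have : (Polynomial.C 2 : Polynomial ℚ) = 2 := rfl
  simp [KP, Kc, Finset.sum_range_succ, mul_add, this]
  try norm_num [this]

lemma descPoch_coeff_zero_of_lt (m k : ℕ) (h : m < k) : (descPochhammer ℚ m).coeff k = 0 := by
  apply Polynomial.coeff_eq_zero_of_natDegree_lt
  rw [descPochhammer_natDegree]; exact h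

lemma Sfun_eq (k n : ℕ) : Sfun k n = (Nat.factorial k : ℚ) * (KP n).coeff k := by
  unfold Sfun
  split_ifs with hk hn
  · subst hk; subst hn; simp [KP_zero]
  · subst hk
    obtain ⟨n, rfl⟩ := Nat.exists_eq_succ_of_ne_zero hn
    simp only [KP, Polynomial.finsetSum_coeff, Ke, Polynomial.coeff_C_mul]
    rw [Finset.sum_eq_zero]
    · simp
    · intro m _
      cases m with
      | zero => simp [Kc]
      | succ m => rw [descPochhammer_succ_left]; simp
  · simp only [KP, Polynomial.finsetSum_coeff, Ke, Polynomial.coeff_C_mul]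
    rw [Finset.mul_sum]
    symm
    have hsub : Finset.Icc k n ⊆ Finset.range (n + 1) := by
      intro x hx; simp at hx ⊢; omega
    rw [← Finset.sum_subset hsub]
    · apply Finset.sum_congr rfl
      intro m hm
      simp at hm
      obtain ⟨m, rfl⟩ : ∃ j, m = j + 1 := ⟨m - 1, by omega⟩
      obtain ⟨n, rfl⟩ : ∃ j, n = j + 1 := ⟨n - 1, by omega⟩
      simp only [Kc, stirling1, Nat.add_sub_cancel]
      ring
    · intro m hm hm'
      simp at hm hm'
      rw [descPoch_coeff_zero_of_lt m k (by by_contra hh; have := hm' (by omega); omega)]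
      simp

noncomputable def KT (k : ℕ) : PowerSeries ℚ := PowerSeries.mk (Sfun k)

lemma X_sq_coeff (f : PowerSeries ℚ) (n : ℕ) :
    PowerSeries.coeff n ((1 - PowerSeries.X ^ 2) * f)
      = PowerSeries.coeff n f - (if 2 ≤ n then PowerSeries.coeff (n - 2) f else 0) := by
  rw [sub_mul, one_mul, map_sub, PowerSeries.coeff_X_pow_mul']

lemma KT_deriv (k : ℕ) :
    (1 - PowerSeries.X ^ 2) * PowerSeries.derivative ℚ (KT (k + 1))
      = PowerSeries.C (2 * ((k : ℚ) + 1)) * KT k := by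
  have key : ∀ (n : ℕ), (2 * Polynomial.X * KP n).coeff (k + 1) = 2 * (KP n).coeff k := by
    intro n
    have : (2 : Polynomial ℚ) = Polynomial.C 2 := rfl
    rw [mul_assoc, this, Polynomial.coeff_C_mul, Polynomial.coeff_X_mul]
  ext n
  rw [X_sq_coeff]
  simp only [PowerSeries.coeff_derivative, KT, PowerSeries.coeff_mk, PowerSeries.coeff_C_mul,
    Sfun_eq, Nat.factorial_succ]
  match n with
  | 0 =>
    have := key 0
    rw [KP_zero] at this ⊢
    rw [zero_add, KP_one]
    rw [mul_one] at this
    rw [this]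
    push_cast; simp; ring
  | 1 =>
    have := key 1
    rw [← KP_two, Polynomial.coeff_C_mul] at this
    push_cast; norm_num
    linear_combination ((k : ℚ) + 1) * (Nat.factorial k) * this
  | p + 2 =>
    have := key (p + 2)
    have h2 := congrArg (fun q => Polynomial.coeff q (k + 1)) (KP_rec p)
    simp only [Polynomial.coeff_add, Polynomial.coeff_C_mul] at h2
    rw [this] at h2
    simp only [Nat.add_sub_cancel, le_add_iff_nonneg_left, zero_le, if_true]
    push_cast
    linear_combination ((k : ℚ) + 1) * (Nat.factorial k) * h2

lemma KA_deriv : (1 - PowerSeries.X ^ 2) * PowerSeries.derivative ℚ KA = 1 := by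
  have hc : ∀ n : ℕ, PowerSeries.coeff n (PowerSeries.derivative ℚ KA) = (1 + (-1) ^ n) / 2 := by
    intro n
    rw [PowerSeries.coeff_derivative, KA, PowerSeries.coeff_mk]
    have : (n : ℚ) + 1 ≠ 0 := by positivity
    push_cast
    field_simp
    ring
  ext n
  rw [X_sq_coeff, hc]
  match n with
  | 0 => simp
  | 1 => simp
  | p + 2 =>
    simp only [Nat.add_sub_cancel, le_add_iff_nonneg_left, zero_le, if_true]
    rw [hc, PowerSeries.coeff_one]
    simp [pow_add]

lemma KT_eq (k : ℕ) : KT k = PowerSeries.C ((2 : ℚ) ^ k) * KA ^ k := by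
  induction k with
  | zero => ext n; simp [KT, Sfun, PowerSeries.coeff_one]
  | succ k ih =>
    apply PowerSeries.derivative.ext
    · have hne : (1 - PowerSeries.X ^ 2 : PowerSeries ℚ) ≠ 0 := by
        intro h
        have := congrArg (PowerSeries.coeff 0) h
        simp at this
      apply mul_left_cancel₀ hne
      rw [KT_deriv, ih, Derivation.leibniz, PowerSeries.derivative_C, Derivation.leibniz_pow]
      simp only [smul_eq_mul, nsmul_eq_mul, mul_zero, add_zero, Nat.add_sub_cancel]
      have e : (PowerSeries.C (2 * ((k : ℚ) + 1)) : PowerSeries ℚ) = 2 * ((k : PowerSeries ℚ) + 1) := by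
        rw [map_mul, map_add, map_natCast, map_one, map_ofNat]
      rw [e]
      simp only [map_pow, map_ofNat]
      push_cast
      linear_combination (-(2 ^ (k+1) * KA ^ k * ((k : PowerSeries ℚ) + 1))) * KA_deriv
    · have : PowerSeries.constantCoeff KA = 0 := by
        rw [← PowerSeries.coeff_zero_eq_constantCoeff_apply]; simp [KA]
      rw [map_mul, map_pow _ KA, this, ← PowerSeries.coeff_zero_eq_constantCoeff_apply]
      simp [KT, Sfun]

lemma Sfun_zero_of_lt (k n : ℕ) (h : n < k) : Sfun k n = 0 := by
  unfold Sfun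
  rw [if_neg (by omega), Finset.Icc_eq_empty (by omega), Finset.sum_empty]

lemma DK1_Xv (N n : ℕ) (hn : n ≤ N) : DK1 N (Xv N n)
    = ∑ p ∈ Finset.HasAntidiagonal.antidiagonal n,
        MvPolynomial.C (PowerSeries.coeff p.1 KA) * Xv N p.2 := by
  rw [Finset.Nat.sum_antidiagonal_eq_sum_range_succ_mk]
  conv_lhs => rw [Xv, dif_pos hn, DK1, MvPolynomial.mkDerivation_X]
  simp only [KA, PowerSeries.coeff_mk]
  apply Finset.sum_subset
  · intro x hx; simp at hx ⊢; omega
  · intro x hx hx'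
    simp at hx hx'
    obtain rfl : x = 0 := by by_contra h; have := hx' (by omega); omega
    simp

lemma DK1_pow_coeff (N k : ℕ) : ∀ n ≤ N, ((DK1 N).toLinearMap ^ k) (Xv N n)
    = PowerSeries.coeff n ((PowerSeries.map MvPolynomial.C KA) ^ k * PowerSeries.mk (Xv N)) := by
  induction k with
  | zero => intro n _; simp
  | succ k ih =>
    intro n hn
    rw [pow_succ, Module.End.mul_apply, show (DK1 N).toLinearMap (Xv N n) = DK1 N (Xv N n) from rfl,
      DK1_Xv N n hn, map_sum, pow_succ', mul_assoc, PowerSeries.coeff_mul]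
    apply Finset.sum_congr rfl
    intro p hp
    have := Finset.HasAntidiagonal.mem_antidiagonal.mp hp
    rw [← MvPolynomial.smul_eq_C_mul, map_smul, PowerSeries.coeff_map, ← ih p.2 (by omega),
      MvPolynomial.smul_eq_C_mul]

/-- `D_{K1}^k(x_n) = 2^{-k} ∑_{i=0}^{n-k} S^{(k)}(n-i) x_i`
(the sum being empty when `k > n`). -/
theorem DK1_pow_X (N k n : ℕ) (hn : n ≤ N) :
    ((DK1 N).toLinearMap ^ k) (Xv N n)
      = MvPolynomial.C (((2 : ℚ) ^ k)⁻¹)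
        * ∑ i ∈ Finset.range (n + 1 - k), MvPolynomial.C (Sfun k (n - i)) * Xv N i := by
  rw [DK1_pow_coeff N k n hn, ← map_pow, PowerSeries.coeff_mul,
    Finset.Nat.sum_antidiagonal_eq_sum_range_succ_mk, ← Finset.sum_range_reflect, Finset.mul_sum]
  symm
  apply Finset.sum_subset_zero_on_sdiff
  · intro x hx; simp at hx ⊢; omega
  · intro i hi
    simp at hi
    have h := congrArg (PowerSeries.coeff (n - i)) (KT_eq k)
    rw [KT, PowerSeries.coeff_mk, Sfun_zero_of_lt k _ (by omega), PowerSeries.coeff_C_mul] at h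
    have h0 : PowerSeries.coeff (n - i) (KA ^ k) = 0 := by
      rcases mul_eq_zero.mp h.symm with h | h
      · exact absurd h (by positivity)
      · exact h
    have e : n + 1 - 1 - i = n - i := by omega
    simp only [e, PowerSeries.coeff_map, h0, map_zero, zero_mul]
  · intro i hi
    simp at hi
    have h := congrArg (PowerSeries.coeff (n - i)) (KT_eq k)
    rw [KT, PowerSeries.coeff_mk, PowerSeries.coeff_C_mul] at h
    have e : n + 1 - 1 - i = n - i := by omega
    have e2 : n - (n - i) = i := by omega
    simp only [e, e2, PowerSeries.coeff_map, PowerSeries.coeff_mk, h]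
    rw [← mul_assoc, ← MvPolynomial.C_mul, inv_mul_cancel_left₀ (by positivity)]
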